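/- Let V be a unital multiplicative partial isometry on H with units 𝟙 ∈ A and 𝟙̂ ∈ Â. Then (Δ(𝟙)⊗1)(1⊗Δ(𝟙)) = (1⊗Δ(𝟙))(Δ(𝟙)⊗1) as operators on H⊗H⊗H, i.e. the two orders of the unit-coproduct projections commute, and both equal V₁₂V₁₃V₁₃*V₁₂*. -/

import Mathlib

open Matrix

namespace MPIpaper

variable {n : Type*} [Fintype n] [DecidableEq n]

noncomputable section

/-- `W₁₂ = W ⊗ 1` on `H ⊗ H ⊗ H`. -/
def leg12 (V : Matrix (n × n) (n × n) ℂ) : Matrix (n × n × n) (n × n × n) ℂ :=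
  Matrix.of fun p q => V (p.1, p.2.1) (q.1, q.2.1) * (if p.2.2 = q.2.2 then (1 : ℂ) else 0)

/-- `W₂₃ = 1 ⊗ W` on `H ⊗ H ⊗ H`. -/
def leg23 (V : Matrix (n × n) (n × n) ℂ) : Matrix (n × n × n) (n × n × n) ℂ :=
  Matrix.of fun p q => (if p.1 = q.1 then (1 : ℂ) else 0) * V p.2 q.2

/-- `W₁₃ = (1⊗Σ)(W⊗1)(1⊗Σ)` on `H ⊗ H ⊗ H`. -/
def leg13 (V : Matrix (n × n) (n × n) ℂ) : Matrix (n × n × n) (n × n × n) ℂ :=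
  Matrix.of fun p q => V (p.1, p.2.2) (q.1, q.2.2) * (if p.2.1 = q.2.1 then (1 : ℂ) else 0)

/-- A multiplicative partial isometry: `VV*V = V`, the pentagon equation, and the
three auxiliary (hexagon-type) equations. -/
def IsMPI (V : Matrix (n × n) (n × n) ℂ) : Prop :=
  V * Vᴴ * V = V ∧
  leg23 V * leg12 V = leg12 V * leg13 V * leg23 V ∧
  leg13 V * leg23 V * (leg23 V)ᴴ = (leg12 V)ᴴ * leg12 V * leg13 V ∧
  leg12 V * (leg12 V)ᴴ * leg23 V = leg23 V * leg12 V * (leg12 V)ᴴ ∧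
  leg12 V * (leg23 V)ᴴ * leg23 V = (leg23 V)ᴴ * leg23 V * leg12 V

/-- `λ(ω) = (ω ⊗ id)(V)`. -/
def lam (ω : Matrix n n ℂ →ₗ[ℂ] ℂ) (V : Matrix (n × n) (n × n) ℂ) : Matrix n n ℂ :=
  Matrix.of fun i j => ω (Matrix.of fun a b => V (a, i) (b, j))

/-- `ρ(ω) = (id ⊗ ω)(V)`. -/
def rho (ω : Matrix n n ℂ →ₗ[ℂ] ℂ) (V : Matrix (n × n) (n × n) ℂ) : Matrix n n ℂ :=
  Matrix.of fun i j => ω (Matrix.of fun a b => V (i, a) (j, b))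

/-- `1 ⊗ X` on `H ⊗ H`. -/
def oneTensor (X : Matrix n n ℂ) : Matrix (n × n) (n × n) ℂ :=
  Matrix.of fun p q => (if p.1 = q.1 then (1 : ℂ) else 0) * X p.2 q.2

/-- `X ⊗ 1` on `H ⊗ H`. -/
def tensorOne (X : Matrix n n ℂ) : Matrix (n × n) (n × n) ℂ :=
  Matrix.of fun p q => X p.1 q.1 * (if p.2 = q.2 then (1 : ℂ) else 0)

/-- `Δ(X) = V (X ⊗ 1) V*`. -/
def Delta (V : Matrix (n × n) (n × n) ℂ) (X : Matrix n n ℂ) : Matrix (n × n) (n × n) ℂ :=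
  V * tensorOne X * Vᴴ

/-- `Δ̂(X) = V* (1 ⊗ X) V`. -/
def hatDelta (V : Matrix (n × n) (n × n) ℂ) (X : Matrix n n ℂ) : Matrix (n × n) (n × n) ℂ :=
  Vᴴ * oneTensor X * V

/-- `(ω ⊗ ω')(W)` for an operator `W` on `H ⊗ H`. -/
def applyBoth (ω ω' : Matrix n n ℂ →ₗ[ℂ] ℂ) (W : Matrix (n × n) (n × n) ℂ) : ℂ :=
  ω (Matrix.of fun i j => ω' (Matrix.of fun k l => W (i, k) (j, l)))

end

/-- The matrix of entries of `V` whose first-leg indices are fixed at `(a, b)`. -/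
def firstLegBlock {k m : Type*} (V : Matrix (k × m) (k × m) ℂ) (a b : k) : Matrix m m ℂ :=
  Matrix.of fun i j => V (a, i) (b, j)

lemma lam_eq_sum (ω : Matrix n n ℂ →ₗ[ℂ] ℂ) (V : Matrix (n × n) (n × n) ℂ) :
    lam ω V = ∑ a, ∑ b, ω (Matrix.single a b 1) • firstLegBlock V a b := by
  ext i j
  have h := Matrix.matrix_eq_sum_single (Matrix.of fun a b => V (a, i) (b, j))
  have hs : ∀ a b : n, Matrix.single a b (V (a, i) (b, j)) =
      V (a, i) (b, j) • Matrix.single a b (1 : ℂ) := by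
    intro a b
    simp
  simp only [lam, Matrix.of_apply]
  rw [h]
  simp only [Matrix.of_apply, hs, map_sum, map_smul, Matrix.sum_apply, Matrix.smul_apply,
    firstLegBlock, smul_eq_mul]
  exact Finset.sum_congr rfl fun a _ => Finset.sum_congr rfl fun b _ => mul_comm _ _

/-- A linear condition satisfied by all blocks of `V` is satisfied by all slices `lam ω V`. -/
lemma linearMap_lam_eq {M : Type*} [AddCommMonoid M] [Module ℂ M] (f g : Matrix n n ℂ →ₗ[ℂ] M)
    (V : Matrix (n × n) (n × n) ℂ)
    (h : ∀ a b, f (firstLegBlock V a b) = g (firstLegBlock V a b))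
    (ω : Matrix n n ℂ →ₗ[ℂ] ℂ) : f (lam ω V) = g (lam ω V) := by
  simp only [lam_eq_sum, map_sum, map_smul, h]

/-- `X ↦ X ⊗ 1` as a linear map. -/
def tensorOneLinear : Matrix n n ℂ →ₗ[ℂ] Matrix (n × n) (n × n) ℂ where
  toFun := tensorOne
  map_add' X Y := by ext; simp only [tensorOne, Matrix.of_apply, Matrix.add_apply, add_mul]
  map_smul' c X := by ext; simp [tensorOne]

/-- `X ↦ 1 ⊗ X` as a linear map. -/
def oneTensorLinear : Matrix n n ℂ →ₗ[ℂ] Matrix (n × n) (n × n) ℂ where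
  toFun := oneTensor
  map_add' X Y := by ext; simp [oneTensor, mul_add]
  map_smul' c X := by ext; simp [oneTensor, mul_left_comm]

lemma leg12_mul (V W : Matrix (n × n) (n × n) ℂ) : leg12 (V * W) = leg12 V * leg12 W := by
  ext ⟨a, b, c⟩ ⟨d, e, f⟩
  by_cases h : c = f <;>
    simp [leg12, Matrix.mul_apply, Fintype.sum_prod_type, h]

lemma leg23_mul (V W : Matrix (n × n) (n × n) ℂ) : leg23 (V * W) = leg23 V * leg23 W := by
  ext ⟨a, b, c⟩ ⟨d, e, f⟩
  by_cases h : a = d <;>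
    simp [leg23, Matrix.mul_apply, Fintype.sum_prod_type, h]

omit [Fintype n] in
lemma leg12_conjTranspose (V : Matrix (n × n) (n × n) ℂ) : leg12 Vᴴ = (leg12 V)ᴴ := by
  ext ⟨a, b, c⟩ ⟨d, e, f⟩
  by_cases h : c = f <;> simp [leg12, Matrix.conjTranspose_apply, h, eq_comm (a := f)]

omit [Fintype n] in
lemma leg23_conjTranspose (V : Matrix (n × n) (n × n) ℂ) : leg23 Vᴴ = (leg23 V)ᴴ := by
  ext ⟨a, b, c⟩ ⟨d, e, f⟩
  by_cases h : a = d <;> simp [leg23, Matrix.conjTranspose_apply, h, eq_comm (a := d)]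

omit [Fintype n] in
lemma leg12_oneTensor (X : Matrix n n ℂ) : leg12 (oneTensor X) = leg23 (tensorOne X) := by
  ext ⟨a, b, c⟩ ⟨d, e, f⟩
  simp [leg12, leg23, oneTensor, tensorOne]

lemma firstLegBlock_leg12_mul_leg23 (V W : Matrix (n × n) (n × n) ℂ) (a b : n) :
    firstLegBlock (leg12 V * leg23 W) a b = tensorOne (firstLegBlock V a b) * W := by
  ext ⟨i, j⟩ ⟨k, l⟩
  simp [firstLegBlock, leg12, leg23, tensorOne, Matrix.mul_apply, Fintype.sum_prod_type]

lemma firstLegBlock_leg23_mul_leg12 (V W : Matrix (n × n) (n × n) ℂ) (a b : n) :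
    firstLegBlock (leg23 W * leg12 V) a b = W * tensorOne (firstLegBlock V a b) := by
  ext ⟨i, j⟩ ⟨k, l⟩
  simp [firstLegBlock, leg12, leg23, tensorOne, Matrix.mul_apply, Fintype.sum_prod_type]

lemma firstLegBlock_leg13_mul_leg23 (V W : Matrix (n × n) (n × n) ℂ) (a b : n) :
    firstLegBlock (leg13 V * leg23 W) a b = oneTensor (firstLegBlock V a b) * W := by
  ext ⟨i, j⟩ ⟨k, l⟩
  simp [firstLegBlock, leg13, leg23, oneTensor, Matrix.mul_apply, Fintype.sum_prod_type]

lemma firstLegBlock_oneTensor_mul (X : Matrix n n ℂ) (V : Matrix (n × n) (n × n) ℂ) (a b : n) :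
    firstLegBlock (oneTensor X * V) a b = X * firstLegBlock V a b := by
  ext i j
  simp [firstLegBlock, oneTensor, Matrix.mul_apply, Fintype.sum_prod_type]

lemma firstLegBlock_mul_oneTensor (X : Matrix n n ℂ) (V : Matrix (n × n) (n × n) ℂ) (a b : n) :
    firstLegBlock (V * oneTensor X) a b = firstLegBlock V a b * X := by
  ext i j
  simp [firstLegBlock, oneTensor, Matrix.mul_apply, Fintype.sum_prod_type]

omit [Fintype n] [DecidableEq n] in
lemma exists_lam_eq_firstLegBlock (V : Matrix (n × n) (n × n) ℂ) (a b : n) :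
    ∃ ω : Matrix n n ℂ →ₗ[ℂ] ℂ, lam ω V = firstLegBlock V a b :=
  ⟨Matrix.entryLinearMap ℂ ℂ a b, rfl⟩

omit [Fintype n] [DecidableEq n] in
lemma eq_of_firstLegBlock_eq {V W : Matrix (n × n) (n × n) ℂ}
    (h : ∀ a b, firstLegBlock V a b = firstLegBlock W a b) : V = W := by
  ext ⟨a, i⟩ ⟨b, j⟩
  exact congrFun (congrFun (h a b) i) j

lemma IsMPI.leg12_mul_leg13 {V : Matrix (n × n) (n × n) ℂ} (hV : IsMPI V) :
    leg12 V * leg13 V = leg23 V * leg12 V * (leg23 V)ᴴ := by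
  obtain ⟨hpi, hpent, hhex, -, -⟩ := hV
  have hpi12 : leg12 V * (leg12 V)ᴴ * leg12 V = leg12 V := by
    rw [← leg12_conjTranspose, ← leg12_mul, ← leg12_mul, hpi]
  rw [hpent, mul_assoc, mul_assoc, ← mul_assoc (leg13 V), hhex, ← mul_assoc, ← mul_assoc, hpi12]

/-- The coproduct of the unit of the second leg is the range projection of `V`. -/
lemma IsMPI.Delta_unit {V : Matrix (n × n) (n × n) ℂ} (hV : IsMPI V)
    (ε : Matrix n n ℂ →ₗ[ℂ] ℂ)
    (hε : ∀ ω : Matrix n n ℂ →ₗ[ℂ] ℂ,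
      lam ε V * lam ω V = lam ω V ∧ lam ω V * lam ε V = lam ω V) :
    Delta V (lam ε V) = V * Vᴴ := by
  obtain ⟨hpi, -, hhex, -, hcomm⟩ := id hV
  have hl : oneTensor (lam ε V) * V = V := eq_of_firstLegBlock_eq fun a b => by
    obtain ⟨ω, hω⟩ := exists_lam_eq_firstLegBlock V a b
    rw [firstLegBlock_oneTensor_mul, ← hω, (hε ω).1]
  have hr : V * oneTensor (lam ε V) = V := eq_of_firstLegBlock_eq fun a b => by
    obtain ⟨ω, hω⟩ := exists_lam_eq_firstLegBlock V a b
    rw [firstLegBlock_mul_oneTensor, ← hω, (hε ω).2]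
  have hF : tensorOne (lam ε V) * (Vᴴ * V) = Vᴴ * V * tensorOne (lam ε V) := by
    refine linearMap_lam_eq (LinearMap.mulRight ℂ (Vᴴ * V) ∘ₗ tensorOneLinear)
      (LinearMap.mulLeft ℂ (Vᴴ * V) ∘ₗ tensorOneLinear) V (fun a b => ?_) ε
    change tensorOne (firstLegBlock V a b) * (Vᴴ * V) = Vᴴ * V * tensorOne (firstLegBlock V a b)
    rw [← firstLegBlock_leg12_mul_leg23, ← firstLegBlock_leg23_mul_leg12, leg23_mul,
      leg23_conjTranspose, ← mul_assoc, hcomm]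
  have hr3 : leg12 V * leg23 (tensorOne (lam ε V)) = leg12 V := by
    rw [← leg12_oneTensor, ← leg12_mul, hr]
  have hcop := IsMPI.leg12_mul_leg13 hV
  have hright : leg12 V * leg13 V * leg23 (Delta V (lam ε V)) = leg12 V * leg13 V := by
    have hD : Vᴴ * Delta V (lam ε V) = tensorOne (lam ε V) * Vᴴ := by
      have hpi' : Vᴴ * V * Vᴴ = Vᴴ := by
        simpa [mul_assoc] using congrArg conjTranspose hpi
      rw [Delta, ← mul_assoc, ← mul_assoc, ← hF, mul_assoc, hpi']
    rw [hcop, mul_assoc, ← leg23_conjTranspose, ← leg23_mul, hD, leg23_mul, ← mul_assoc,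
      mul_assoc (leg23 V), hr3]
  have hED : V * Vᴴ * Delta V (lam ε V) = Delta V (lam ε V) := by
    simp only [Delta, ← mul_assoc, hpi]
  have h13 : leg13 V * leg23 (Delta V (lam ε V)) = leg13 V * leg23 (V * Vᴴ) := by
    have h1 : leg13 V * leg23 (V * Vᴴ) = (leg12 V)ᴴ * (leg12 V * leg13 V) := by
      rw [leg23_mul, leg23_conjTranspose, ← mul_assoc, hhex, mul_assoc]
    calc _ = leg13 V * leg23 (V * Vᴴ) * leg23 (Delta V (lam ε V)) := by
          rw [mul_assoc, ← leg23_mul, hED]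
      _ = _ := by rw [h1, mul_assoc, hright]
  have h1 : oneTensor (lam ε V) * Delta V (lam ε V) = oneTensor (lam ε V) * (V * Vᴴ) := by
    refine linearMap_lam_eq (LinearMap.mulRight ℂ (Delta V (lam ε V)) ∘ₗ oneTensorLinear)
      (LinearMap.mulRight ℂ (V * Vᴴ) ∘ₗ oneTensorLinear) V (fun a b => ?_) ε
    change oneTensor (firstLegBlock V a b) * Delta V (lam ε V) =
      oneTensor (firstLegBlock V a b) * (V * Vᴴ)
    rw [← firstLegBlock_leg13_mul_leg23, ← firstLegBlock_leg13_mul_leg23, h13]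
  simpa only [Delta, ← mul_assoc, hl] using h1

theorem statement13 (V : Matrix (n × n) (n × n) ℂ) (hV : IsMPI V)
    (ε εhat : Matrix n n ℂ →ₗ[ℂ] ℂ)
    (hεhat : ∀ ω : Matrix n n ℂ →ₗ[ℂ] ℂ,
      lam εhat V * lam ω V = lam ω V ∧ lam ω V * lam εhat V = lam ω V)
    (hε : ∀ ω : Matrix n n ℂ →ₗ[ℂ] ℂ,
      rho ε V * rho ω V = rho ω V ∧ rho ω V * rho ε V = rho ω V) :
    leg12 (Delta V (lam εhat V)) * leg23 (Delta V (lam εhat V)) =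
      leg23 (Delta V (lam εhat V)) * leg12 (Delta V (lam εhat V)) ∧
    leg12 (Delta V (lam εhat V)) * leg23 (Delta V (lam εhat V)) =
      leg12 V * leg13 V * (leg13 V)ᴴ * (leg12 V)ᴴ := by
  rw [hV.Delta_unit εhat hεhat]
  have hcop := hV.leg12_mul_leg13
  obtain ⟨hpi, -, -, hE, hF⟩ := hV
  simp only [leg12_mul, leg23_mul, leg12_conjTranspose, leg23_conjTranspose]
  have hE' : (leg23 V)ᴴ * (leg12 V * (leg12 V)ᴴ) = leg12 V * (leg12 V)ᴴ * (leg23 V)ᴴ := by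
    simpa [mul_assoc] using congrArg conjTranspose hE
  have hpi23 : leg23 V * (leg23 V)ᴴ * leg23 V = leg23 V := by
    rw [← leg23_conjTranspose, ← leg23_mul, ← leg23_mul, hpi]
  constructor
  · rw [← mul_assoc, hE, mul_assoc (leg23 V) (leg23 V)ᴴ, hE']
    simp only [mul_assoc]
  · have hcop' : (leg13 V)ᴴ * (leg12 V)ᴴ = leg23 V * (leg12 V)ᴴ * (leg23 V)ᴴ := by
      simpa [mul_assoc] using congrArg conjTranspose hcop
    calc leg12 V * (leg12 V)ᴴ * (leg23 V * (leg23 V)ᴴ)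
        = leg23 V * (leg12 V * (leg12 V)ᴴ) * (leg23 V)ᴴ := by
          rw [← mul_assoc, hE, mul_assoc (leg23 V)]
      _ = leg23 V * (leg23 V)ᴴ * leg23 V * (leg12 V * (leg12 V)ᴴ) * (leg23 V)ᴴ := by rw [hpi23]
      _ = leg23 V * ((leg23 V)ᴴ * leg23 V * leg12 V) * (leg12 V)ᴴ * (leg23 V)ᴴ := by
          simp only [mul_assoc]
      _ = leg23 V * leg12 V * (leg23 V)ᴴ * (leg23 V * (leg12 V)ᴴ * (leg23 V)ᴴ) := by
          rw [← hF]
          simp only [mul_assoc]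
      _ = leg12 V * leg13 V * (leg13 V)ᴴ * (leg12 V)ᴴ := by
          rw [← hcop, ← hcop', ← mul_assoc]

end MPIpaper
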